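/- arXiv:1308.5459 — 2 statements merged into one kernel-verified Lean document; each statement's English description precedes it below -/
import Mathlib

section
/- For any subset {k_1,...,k_m} ⊆ [n] with 1 ≤ m ≤ n-1, the number of permutations π of [n] satisfying π(k_i + 1 mod n) = π(k_i) + 1 mod n for all 1 ≤ i ≤ m equals n·(n-m-1)!. -/
/-- The successor `k+1 mod n`, taking values in `Fin n`. -/
def cyclicSucc {n : ℕ} (j : Fin n) : Fin n := ⟨((j : ℕ) + 1) % n, Nat.mod_lt _ j.pos⟩

open Equiv Equiv.Perm

theorem mem_filt {β : Type*} (i : Fintype β) (p : β → Prop) (h : DecidablePred p) (x : β) :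
    x ∈ @Finset.filter β p h (@Finset.univ β i) ↔ p x := by
  simp

/-- `σ` acts as a single cycle on `S` and fixes everything outside `S`. -/
def CycP {α : Type*} (S : Finset α) (σ : Perm α) : Prop :=
  (∀ x, x ∉ S → σ x = x) ∧ ∀ x ∈ S, ∀ y ∈ S, SameCycle σ x y

theorem sameCycle_of_step {α β : Type*} (σ : Perm α) (τ : Perm β) (r : α → β)
    (h : ∀ x, SameCycle τ (r x) (r (σ x))) {x y : α} (hxy : SameCycle σ x y) :
    SameCycle τ (r x) (r y) := by
  obtain ⟨i, rfl⟩ := hxy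
  induction i using Int.induction_on with
  | zero => exact SameCycle.refl _ _
  | succ i ih =>
    have := h ((σ ^ (i : ℤ)) x)
    rw [add_comm, zpow_add, zpow_one, Perm.mul_apply]
    exact ih.trans this
  | pred i ih =>
    have := h ((σ ^ (-(i : ℤ) - 1)) x)
    rw [← Perm.mul_apply, ← zpow_one_add, add_sub_cancel] at this
    exact ih.trans this.symm

theorem cycP_swap {α : Type*} [DecidableEq α] (S : Finset α) (k b : α) (hk : k ∈ S) (hb : b ∈ S)
    (hkb : k ≠ b) (τ : Perm α) :
    (CycP S (swap k b * τ) ∧ (swap k b * τ) k = b) ↔ CycP (S.erase k) τ := by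
  constructor
  · rintro ⟨⟨h1, h2⟩, h3⟩
    have hτk : τ k = k := by
      rw [Perm.mul_apply, Equiv.swap_apply_eq_iff, swap_apply_right] at h3; exact h3
    constructor
    · intro x hx
      by_cases hxk : x = k
      · rw [hxk, hτk]
      · have hxS : x ∉ S := fun h => hx (Finset.mem_erase.2 ⟨hxk, h⟩)
        have := h1 x hxS
        rw [Perm.mul_apply, Equiv.swap_apply_eq_iff, swap_apply_of_ne_of_ne hxk] at this
        · exact this
        · rintro rfl; exact hxS hb
    · intro x hx y hy
      rw [Finset.mem_erase] at hx hy
      have := sameCycle_of_step (swap k b * τ) τ (fun z => if z = k then b else z) ?_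
        (h2 x hx.2 y hy.2)
      · simpa [hx.1, hy.1] using this
      · intro z
        by_cases hz : z = k
        · subst hz
          simp [hτk, hkb.symm, SameCycle.refl]
        · have h4 : τ z ≠ k := fun h => hz (τ.injective (h.trans hτk.symm))
          by_cases h5 : τ z = b
          · simp only [Perm.mul_apply, h5, swap_apply_right, if_true, hz, if_false]
            exact ⟨1, by simpa using h5⟩
          · simp only [Perm.mul_apply, swap_apply_of_ne_of_ne h4 h5, hz, h4, if_false]
            exact ⟨1, by simp⟩
  · rintro ⟨h1, h2⟩
    have hτk : τ k = k := h1 k (by simp)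
    have hσk : (swap k b * τ) k = b := by simp [hτk]
    refine ⟨⟨?_, ?_⟩, hσk⟩
    · intro x hx
      have hxk : x ≠ k := by rintro rfl; exact hx hk
      have hxb : x ≠ b := by rintro rfl; exact hx hb
      rw [Perm.mul_apply, h1 x (fun h => hx (Finset.mem_of_mem_erase h)),
        swap_apply_of_ne_of_ne hxk hxb]
    · have key : ∀ z, SameCycle (swap k b * τ) z (τ z) := by
        intro z
        by_cases hz : z = k
        · subst hz; rw [hτk]
        · have h4 : τ z ≠ k := fun h => hz (τ.injective (h.trans hτk.symm))
          by_cases h5 : τ z = b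
          · have h6 : (swap k b * τ) z = k := by simp [h5]
            rw [h5]
            exact ⟨2, by rw [zpow_two, Perm.mul_apply, h6, hσk]⟩
          · exact ⟨1, by simp [swap_apply_of_ne_of_ne h4 h5]⟩
      have hkb' : SameCycle (swap k b * τ) k b := ⟨1, by simpa using hσk⟩
      have key2 : ∀ x ∈ S, SameCycle (swap k b * τ) x b := by
        intro x hx
        by_cases hxk : x = k
        · rw [hxk]; exact hkb'
        · exact sameCycle_of_step τ (swap k b * τ) id key
            (h2 x (Finset.mem_erase.2 ⟨hxk, hx⟩) b (Finset.mem_erase.2 ⟨hkb.symm, hb⟩))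
      intro x hx y hy
      exact (key2 x hx).trans (key2 y hy).symm

open Classical in
theorem card_step {α : Type*} [Fintype α] (S : Finset α) (k b : α) (hk : k ∈ S)
    (hb : b ∈ S) (hkb : k ≠ b) (Q : Perm α → Prop) :
    (Finset.univ.filter (fun σ : Perm α => (CycP S σ ∧ σ k = b) ∧ Q σ)).card =
    (Finset.univ.filter (fun τ : Perm α => CycP (S.erase k) τ ∧ Q (swap k b * τ))).card := by
  symm
  apply Finset.card_equiv (Equiv.mulLeft (swap k b))
  intro τ
  simp only [Finset.mem_filter, Finset.mem_univ, true_and, Equiv.coe_mulLeft]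
  rw [cycP_swap S k b hk hb hkb]

open Classical in
theorem card_all {α : Type*} [Fintype α] (N : ℕ) : ∀ S : Finset α, S.card = N + 1 →
    (Finset.univ.filter (fun σ : Perm α => CycP S σ)).card = N.factorial := by
  induction N with
  | zero =>
    intro S hS
    obtain ⟨a, rfl⟩ := Finset.card_eq_one.1 hS
    rw [Nat.factorial_zero, Finset.card_eq_one]
    refine ⟨1, ?_⟩
    ext σ
    simp only [Finset.mem_filter, Finset.mem_univ, true_and, Finset.mem_singleton]
    constructor
    · rintro ⟨h, -⟩
      ext x
      by_cases hx : x = a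
      · subst hx
        by_contra h'
        have h2 := h (σ x) (by simpa using h')
        exact h' (σ.injective h2)
      · exact h x (by simpa using hx)
    · rintro rfl
      refine ⟨fun _ _ => rfl, ?_⟩
      intro x hx y hy
      rw [Finset.mem_singleton] at hx hy
      rw [hx, hy]
  | succ N ih =>
    intro S hS
    obtain ⟨k, hk⟩ : S.Nonempty := Finset.card_pos.1 (by omega)
    have hc : (S.erase k).card = N + 1 := by rw [Finset.card_erase_of_mem hk, hS]; rfl
    rw [Finset.card_eq_sum_card_fiberwise (f := fun σ : Perm α => σ k) (t := S.erase k)]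
    · rw [Finset.sum_congr rfl (g := fun _ => N.factorial)]
      · rw [Finset.sum_const, hc, Nat.factorial_succ, smul_eq_mul]
      · intro b hb
        rw [Finset.mem_erase] at hb
        have := card_step S k b hk hb.2 hb.1.symm (fun _ => True)
        simp only [and_true] at this
        rw [Finset.filter_filter, this, ih _ hc]
    · intro σ hσ
      simp only [Finset.coe_filter, Finset.mem_univ, true_and, Set.mem_ofPred_eq] at hσ
      simp only [Finset.coe_erase, Set.mem_sdiff, Finset.mem_coe, Set.mem_singleton_iff]
      constructor
      · by_contra h
        have := hσ.1 _ h
        have h2 := σ.injective this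
        rw [h2] at h
        exact h hk
      · intro h
        obtain ⟨y, hy⟩ : (S.erase k).Nonempty := Finset.card_pos.1 (by omega)
        rw [Finset.mem_erase] at hy
        obtain ⟨i, hi⟩ := hσ.2 k hk y hy.2
        rw [zpow_apply_eq_self_of_apply_eq_self h] at hi
        exact hy.1 hi.symm

open Classical in
theorem card_agree {α : Type*} [Fintype α] (m : ℕ) : ∀ (S K : Finset α) (c : Perm α),
    K ⊂ S → K.card = m → CycP S c →
    (Finset.univ.filter (fun σ : Perm α => CycP S σ ∧ ∀ k ∈ K, σ k = c k)).card
      = (S.card - m - 1).factorial := by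
  induction m with
  | zero =>
    intro S K c hK hm _
    rw [Finset.card_eq_zero] at hm
    subst hm
    have : 0 < S.card := Finset.card_pos.2 (Finset.empty_ssubset.1 hK)
    simp only [Finset.notMem_empty, false_imp_iff, implies_true, and_true]
    exact card_all _ S (by omega)
  | succ m ih =>
    intro S K c hK hm hc
    obtain ⟨k, hkK⟩ : K.Nonempty := Finset.card_pos.1 (by omega)
    have hk : k ∈ S := hK.1 hkK
    obtain ⟨y, hyS, hyK⟩ := Finset.exists_of_ssubset hK
    have hky : k ≠ y := by rintro rfl; exact hyK hkK
    have hb : c k ∈ S := by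
      by_contra h
      have h2 := c.injective (hc.1 _ h)
      rw [h2] at h
      exact h hk
    have hkb : k ≠ c k := by
      intro h
      obtain ⟨i, hi⟩ := hc.2 k hk y hyS
      rw [zpow_apply_eq_self_of_apply_eq_self h.symm] at hi
      exact hky hi
    have hc' : CycP (S.erase k) (swap k (c k) * c) := by
      rw [← cycP_swap S k (c k) hk hb hkb, swap_mul_self_mul]
      exact ⟨hc, rfl⟩
    have h1 := ih (S.erase k) (K.erase k) (swap k (c k) * c) ?_
      (by rw [Finset.card_erase_of_mem hkK, hm]; rfl) hc'
    · have h2 := card_step S k (c k) hk hb hkb (fun σ => ∀ x ∈ K.erase k, σ x = c x)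
      have h3 : (S.erase k).card - m - 1 = S.card - (m + 1) - 1 := by
        rw [Finset.card_erase_of_mem hk]; omega
      rw [← h3, ← h1]
      convert h2 using 2
      · ext σ
        simp only [Finset.mem_filter, Finset.mem_univ, true_and, Finset.mem_erase]
        constructor
        · rintro ⟨h, h'⟩
          exact ⟨⟨h, h' k hkK⟩, fun x hx => h' x hx.2⟩
        · rintro ⟨⟨h, h'⟩, h''⟩
          refine ⟨h, fun x hx => ?_⟩
          by_cases hxk : x = k
          · rw [hxk, h']
          · exact h'' x ⟨hxk, hx⟩
      · ext τ
        refine (mem_filt _ _ _ _).trans (Iff.trans ?_ (mem_filt _ _ _ _).symm)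
        simp only [Perm.mul_apply]
        refine and_congr_right fun _ => forall_congr' fun x => imp_congr_right fun _ => ?_
        constructor
        · intro h
          rw [h, swap_apply_self]
        · intro h
          rw [← h, swap_apply_self]
    · rw [Finset.ssubset_iff_of_subset (Finset.erase_subset_erase _ hK.1)]
      exact ⟨y, Finset.mem_erase.2 ⟨hky.symm, hyS⟩, fun h => hyK (Finset.mem_of_mem_erase h)⟩

theorem cycP_univ_iff {α : Type*} [Fintype α] [DecidableEq α] [Nontrivial α] (σ : Perm α) :
    CycP Finset.univ σ ↔ σ.IsCycle ∧ σ.support = Finset.univ := by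
  constructor
  · rintro ⟨-, h⟩
    have hne : ∀ x, σ x ≠ x := by
      intro x hx
      obtain ⟨y, hy⟩ := exists_ne x
      obtain ⟨i, hi⟩ := h x (Finset.mem_univ _) y (Finset.mem_univ _)
      rw [zpow_apply_eq_self_of_apply_eq_self hx] at hi
      exact hy hi.symm
    obtain ⟨x, -⟩ := exists_pair_ne α
    refine ⟨⟨x, hne x, fun y _ => h x (Finset.mem_univ _) y (Finset.mem_univ _)⟩, ?_⟩
    ext y
    simp [hne y]
  · rintro ⟨h, h'⟩
    refine ⟨fun x hx => absurd (Finset.mem_univ x) hx, fun x _ y _ => ?_⟩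
    have : ∀ z, σ z ≠ z := fun z => by rw [← mem_support, h']; exact Finset.mem_univ z
    exact h.sameCycle (this x) (this y)

theorem cycP_univ_iff_conj {α : Type*} [Fintype α] [DecidableEq α] [Nontrivial α] (c σ : Perm α)
    (hc : CycP Finset.univ c) :
    CycP Finset.univ σ ↔ ∃ π : Perm α, π⁻¹ * c * π = σ := by
  constructor
  · intro h
    rw [cycP_univ_iff] at h hc
    have := (hc.1.isConj_iff h.1).2 (by rw [hc.2, h.2])
    obtain ⟨π, hπ⟩ := isConj_iff.1 this
    exact ⟨π⁻¹, by simpa using hπ⟩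
  · rintro ⟨π, rfl⟩
    refine ⟨fun x hx => absurd (Finset.mem_univ x) hx, fun x _ y _ => ?_⟩
    have := sameCycle_of_step c (π⁻¹ * c * π) (fun z => π⁻¹ z) ?_
      (hc.2 (π x) (Finset.mem_univ _) (π y) (Finset.mem_univ _))
    · simpa using this
    · intro z
      exact ⟨1, by simp⟩

open Classical in
theorem card_fiber {α : Type*} [Fintype α] (c ρ : Perm α) :
    (Finset.univ.filter (fun π : Perm α => π⁻¹ * c * π = ρ⁻¹ * c * ρ)).card =
    (Finset.univ.filter (fun π : Perm α => π⁻¹ * c * π = c)).card := by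
  apply Finset.card_equiv (Equiv.mulRight ρ⁻¹)
  intro π
  simp only [Finset.mem_filter, Finset.mem_univ, true_and, Equiv.coe_mulRight]
  constructor
  · intro h
    calc _ = ρ * (π⁻¹ * c * π) * ρ⁻¹ := by group
      _ = c := by rw [h]; group
  · intro h
    calc _ = ρ⁻¹ * ((π * ρ⁻¹)⁻¹ * c * (π * ρ⁻¹)) * ρ := by group
      _ = _ := by rw [h]

open Classical in
theorem card_perm {α : Type*} [Fintype α] [Nontrivial α] (c : Perm α)
    (hc : CycP Finset.univ c) (Q : Perm α → Prop) :
    (Finset.univ.filter (fun π : Perm α => Q (π⁻¹ * c * π))).card =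
    (Finset.univ.filter (fun σ : Perm α => CycP Finset.univ σ ∧ Q σ)).card *
    (Finset.univ.filter (fun π : Perm α => π⁻¹ * c * π = c)).card := by
  rw [Finset.card_eq_sum_card_fiberwise (f := fun π : Perm α => π⁻¹ * c * π)
    (t := Finset.univ.filter (fun σ : Perm α => CycP Finset.univ σ ∧ Q σ)),
    Finset.sum_congr rfl, Finset.sum_const, smul_eq_mul]
  · intro σ hσ
    simp only [Finset.mem_filter, Finset.mem_univ, true_and] at hσ
    obtain ⟨ρ, rfl⟩ := (cycP_univ_iff_conj c σ hc).1 hσ.1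
    rw [← card_fiber c ρ, Finset.filter_filter]
    congr 1
    ext π
    simp only [Finset.mem_filter, Finset.mem_univ, true_and]
    exact ⟨fun h => h.2, fun h => ⟨h ▸ hσ.2, h⟩⟩
  · intro π hπ
    simp only [Finset.coe_filter, Finset.mem_univ, true_and, Set.mem_ofPred_eq] at hπ ⊢
    exact ⟨(cycP_univ_iff_conj c _ hc).2 ⟨π, rfl⟩, hπ⟩

open Classical in
theorem card_centr {α : Type*} [Fintype α] [Nontrivial α] (c : Perm α)
    (hc : CycP Finset.univ c) :
    (Finset.univ.filter (fun π : Perm α => π⁻¹ * c * π = c)).card = Fintype.card α := by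
  have h := card_perm c hc (fun _ => True)
  obtain ⟨N, hN⟩ : ∃ N, Fintype.card α = N + 1 := ⟨Fintype.card α - 1, by
    have := Fintype.card_pos (α := α); omega⟩
  simp only [and_true, Finset.filter_true] at h
  rw [card_all N Finset.univ (by rw [Finset.card_univ, hN]), Finset.card_univ, Fintype.card_perm,
    hN, Nat.factorial_succ, mul_comm] at h
  rw [hN]
  exact (Nat.eq_of_mul_eq_mul_left (Nat.factorial_pos N) h).symm

/-- For any subset `K = {k_1,…,k_m} ⊆ [n]` with `1 ≤ m ≤ n-1`, the number of permutations
`π` of `[n]` with `π(k + 1 mod n) = π(k) + 1 mod n` for all `k ∈ K` is `n·(n-m-1)!`. -/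
theorem stmt9 (n m : ℕ) (hm1 : 1 ≤ m) (hm2 : m ≤ n - 1) (K : Finset (Fin n))
    (hcard : K.card = m) :
    (Finset.univ.filter (fun π : Equiv.Perm (Fin n) =>
      ∀ k ∈ K, π (cyclicSucc k) = cyclicSucc (π k))).card
    = n * Nat.factorial (n - m - 1) := by
  classical
  obtain ⟨N, rfl⟩ : ∃ N, n = N + 2 := ⟨n - 2, by omega⟩
  have hs : ∀ j : Fin (N + 2), cyclicSucc j = finRotate (N + 2) j := by
    intro j
    rw [finRotate_apply]
    apply Fin.ext
    simp [cyclicSucc, Fin.val_add]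
  have hc : CycP Finset.univ (finRotate (N + 2)) :=
    (cycP_univ_iff _).2 ⟨isCycle_finRotate, support_finRotate⟩
  have hK : K ⊂ Finset.univ := by
    rw [Finset.ssubset_univ_iff]
    rintro rfl
    simp at hcard
    omega
  have h1 := card_agree m Finset.univ K _ hK hcard hc
  have h2 := card_perm _ hc (fun σ => ∀ k ∈ K, σ k = finRotate (N + 2) k)
  refine Eq.trans ?_ (h2.trans ?_)
  · congr 1
    ext π
    refine (mem_filt _ _ _ _).trans (Iff.trans ?_ (mem_filt _ _ _ _).symm)
    simp only [hs, Perm.mul_apply]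
    refine forall_congr' fun k => imp_congr_right fun _ => ?_
    rw [Perm.inv_eq_iff_eq, eq_comm]
  · rw [Finset.card_univ, Fintype.card_fin] at h1
    rw [card_centr _ hc, Fintype.card_fin, mul_comm, ← h1]
    congr!
end

section
/- For a uniformly random permutation Π of [n], let U_n = {k ∈ [n] : Π(k+1 mod n) = Π(k)+1 mod n}. Then P{#U_n = m} = (1/m!)·(Σ_{h=0}^{n-m-1} (-1)^h (1/h!) · n/(n-m-h) + (-1)^{n-m} · n/(n-m)!) for 0 ≤ m ≤ n. -/
namespace CycPerm

/-- `τ` has a single orbit. -/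
def FullCyc {α : Type} (τ : Equiv.Perm α) : Prop := ∀ x y, τ.SameCycle x y

open Equiv Equiv.Perm

theorem removeNone_step {α : Type} (τ : Perm (Option α)) (x : α) :
    τ.SameCycle (some x) (some (removeNone τ x)) := by
  cases h : τ (some x) with
  | none =>
    rw [removeNone_none τ h, ← h, sameCycle_apply_right, sameCycle_apply_right]
  | some y =>
    rw [removeNone_some τ ⟨y, h⟩, sameCycle_apply_right]

theorem sameCycle_of_removeNone {α : Type} [Finite α] (τ : Perm (Option α)) (x y : α)
    (h : SameCycle (removeNone τ) x y) : τ.SameCycle (some x) (some y) := by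
  obtain ⟨k, rfl⟩ := h.exists_nat_pow_eq
  induction k with
  | zero => exact SameCycle.refl _ _
  | succ k ih =>
    rw [pow_succ', Perm.mul_apply]
    exact (ih ⟨k, by simp⟩).trans (removeNone_step τ _)

theorem removeNone_sameCycle_aux {α : Type} (τ : Perm (Option α)) (k : ℕ) :
    ∀ x y : α, (τ ^ k) (some x) = some y → SameCycle (removeNone τ) x y := by
  induction k using Nat.strong_induction_on with
  | _ k ih =>
    intro x y h
    match k, ih, h with
    | 0, _, h =>
      simp at h; subst h; exact SameCycle.refl _ _
    | k + 1, ih, h =>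
      rw [pow_succ, Perm.mul_apply] at h
      cases h1 : τ (some x) with
      | some z =>
        rw [h1] at h
        have h2 := ih k (by omega) z y h
        have h3 := removeNone_some τ ⟨z, h1⟩
        rw [h1, Option.some_inj] at h3
        rw [← h3, sameCycle_apply_left] at h2
        exact h2
      | none =>
        rw [h1] at h
        match k, ih, h with
        | 0, _, h => simp at h
        | k + 1, ih, h =>
          rw [pow_succ, Perm.mul_apply] at h
          have h3 := removeNone_none τ h1
          rw [← h3] at h
          have h2 := ih k (by omega) _ y h
          rwa [sameCycle_apply_left] at h2

theorem fullCyc_removeNone_iff {α : Type} [Finite α] (τ : Perm (Option α)) (h0 : τ none ≠ none) :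
    FullCyc (removeNone τ) ↔ FullCyc τ := by
  constructor
  · intro h
    obtain ⟨z, hz⟩ := Option.ne_none_iff_exists'.1 h0
    have hs : ∀ x, τ.SameCycle (some z) x := by
      intro x
      cases x with
      | none => rw [← hz, sameCycle_apply_left]
      | some x => exact sameCycle_of_removeNone τ _ _ (h z x)
    intro x y
    exact (hs x).symm.trans (hs y)
  · intro h x y
    obtain ⟨k, hk⟩ := (h (some x) (some y)).exists_nat_pow_eq
    exact removeNone_sameCycle_aux τ k x y hk

theorem FullCyc.ne {α : Type} [Nontrivial α] {τ : Perm α} (h : FullCyc τ) (a : α) : τ a ≠ a := by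
  intro ha
  obtain ⟨b, hb⟩ := exists_ne a
  exact hb ((h a b).eq_of_left ha).symm

theorem fullCyc_permCongr {α β : Type} (e : α ≃ β) (τ : Perm α) :
    FullCyc (e.permCongr τ) ↔ FullCyc τ := by
  have key : ∀ {α β : Type} (e : α ≃ β) (τ : Perm α), FullCyc τ → FullCyc (e.permCongr τ) := by
    intro α β e τ h x y
    obtain ⟨k, hk⟩ := h (e.symm x) (e.symm y)
    refine ⟨k, ?_⟩
    have : (e.permCongr τ) ^ k = e.permCongr (τ ^ k) :=
      (map_zpow e.permCongrHom τ k).symm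
    rw [this, Equiv.permCongr_apply, hk, Equiv.apply_symm_apply]
  refine ⟨fun h => ?_, key e τ⟩
  have := key e.symm _ h
  convert this using 1
  ext x; simp

theorem card_fullCyc (n : ℕ) : ∀ (α : Type) [Fintype α], Fintype.card α = n + 1 →
    Nat.card {τ : Perm α // FullCyc τ} = n.factorial := by
  classical
  induction n with
  | zero =>
    intro α _ h
    have : Subsingleton α := Fintype.card_le_one_iff_subsingleton.1 (by omega)
    have : Unique {τ : Perm α // FullCyc τ} :=
      { default := ⟨1, fun x y => by rw [Subsingleton.elim x y]⟩
        uniq := fun a => Subsingleton.elim _ _ }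
    simp
  | succ n ih =>
    intro α _ h
    have : Nonempty α := Fintype.card_pos_iff.1 (by omega)
    obtain ⟨a⟩ := this
    have hb : Fintype.card {b // b ≠ a} = n + 1 := by
      rw [Fintype.card_subtype_compl]; simp [h]
    have hne : Nonempty {b // b ≠ a} := Fintype.card_pos_iff.1 (by omega)
    have e1 : {τ : Perm α // FullCyc τ} ≃ {τ : Perm (Option {b // b ≠ a}) // FullCyc τ} :=
      (Equiv.subtypeEquiv (optionSubtypeNe a).permCongr
        (fun τ => (fullCyc_permCongr _ _).symm)).symm
    have e2 : {τ : Perm (Option {b // b ≠ a}) // FullCyc τ} ≃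
        {p : Option {b // b ≠ a} × Perm {b // b ≠ a} // p.1 ≠ none ∧ FullCyc p.2} :=
      Equiv.subtypeEquiv decomposeOption (fun τ => by
        simp only [decomposeOption_apply]
        constructor
        · intro h
          exact ⟨h.ne _, (fullCyc_removeNone_iff τ (h.ne _)).2 h⟩
        · rintro ⟨h1, h2⟩
          exact (fullCyc_removeNone_iff τ h1).1 h2)
    rw [Nat.card_congr e1, Nat.card_congr e2,
      Nat.card_congr (Equiv.subtypeProdEquivProd (p := fun x => x ≠ none) (q := FullCyc)),
      Nat.card_prod, ih _ hb, Nat.factorial_succ]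
    congr 1
    rw [Nat.card_eq_fintype_card, Fintype.card_subtype_compl]
    simp [h]

/-- single orbit permutations which agree with `σ` on `S` -/
def Agree {α : Type} (σ : Perm α) (S : Finset α) : Type :=
  {τ : Perm α // FullCyc τ ∧ ∀ k ∈ S, τ k = σ k}

theorem card_agree (s : ℕ) : ∀ (α : Type) [Fintype α] (σ : Perm α) (S : Finset α), FullCyc σ →
    S.card = s → s < Fintype.card α →
    Nat.card (Agree σ S) = (Fintype.card α - s - 1).factorial := by
  classical
  induction s with
  | zero =>
    intro α _ σ S hσ hS h
    rw [Finset.card_eq_zero] at hS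
    subst hS
    rw [← card_fullCyc (Fintype.card α - 0 - 1) α (by omega)]
    exact Nat.card_congr (Equiv.subtypeEquivRight (by simp))
  | succ s ih =>
    intro α _ σ S hσ hS h
    obtain ⟨a, ha⟩ : S.Nonempty := Finset.card_pos.1 (by omega)
    have hb : Fintype.card {b // b ≠ a} = Fintype.card α - 1 := by
      rw [Fintype.card_subtype_compl]; simp
    have hne : Nonempty {b // b ≠ a} := Fintype.card_pos_iff.1 (by omega)
    let e := optionSubtypeNe a
    let σ' := e.symm.permCongr σ
    have hσ' : FullCyc σ' := (fullCyc_permCongr _ _).2 hσ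
    have hn := hσ'.ne none
    let S' : Finset {b // b ≠ a} := S.subtype (· ≠ a)
    have hS' : S'.card = s := by
      rw [Finset.card_subtype, Finset.filter_ne', Finset.card_erase_of_mem ha, hS]; rfl
    have e1 : Agree σ S ≃ {τ : Perm (Option {b // b ≠ a}) // FullCyc τ ∧
        τ none = σ' none ∧ ∀ k ∈ S', τ (some k) = σ' (some k)} :=
      Equiv.subtypeEquiv e.symm.permCongr (fun τ => by
        rw [fullCyc_permCongr]
        refine and_congr_right fun _ => ?_
        simp only [Equiv.permCongr_apply, σ', Equiv.symm_symm, e.symm.injective.eq_iff]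
        constructor
        · intro H
          exact ⟨H a ha, fun k hk => H k (Finset.mem_subtype.1 hk)⟩
        · rintro ⟨H1, H2⟩ k hk
          by_cases hka : k = a
          · subst hka; exact H1
          · exact H2 ⟨k, hka⟩ (Finset.mem_subtype.2 hk))
    have e2 : {τ : Perm (Option {b // b ≠ a}) // FullCyc τ ∧
        τ none = σ' none ∧ ∀ k ∈ S', τ (some k) = σ' (some k)} ≃
        {p : Option {b // b ≠ a} × Perm {b // b ≠ a} // p.1 = σ' none ∧
          (FullCyc p.2 ∧ ∀ k ∈ S', p.2 k = removeNone σ' k)} :=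
      Equiv.subtypeEquiv decomposeOption (fun τ => by
        simp only [decomposeOption_apply]
        by_cases h1 : τ none = σ' none
        · rw [← fullCyc_removeNone_iff τ (h1 ▸ hn)]
          simp only [h1, true_and]
          refine and_congr_right fun _ => forall_congr' fun k => forall_congr' fun hk => ?_
          rw [← Option.some_inj (a := removeNone τ k)]
          have i1 : τ (some k) ≠ τ none := fun h => by simpa using τ.injective h
          have i2 : σ' (some k) ≠ σ' none := fun h => by simpa using σ'.injective h
          cases ht : τ (some k) with
          | none =>
            rw [removeNone_none τ ht]
            cases hs : σ' (some k) with
            | none => rw [removeNone_none σ' hs]; simp [h1]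
            | some y =>
              rw [removeNone_some σ' ⟨_, hs⟩, h1]
              simp [i2.symm]
          | some z =>
            rw [removeNone_some τ ⟨_, ht⟩]
            cases hs : σ' (some k) with
            | none =>
              rw [removeNone_none σ' hs, ← h1]
              simp [i1]
            | some y => rw [removeNone_some σ' ⟨_, hs⟩, hs, ht]
        · simp [h1])
    rw [Nat.card_congr e1, Nat.card_congr e2,
      Nat.card_congr (Equiv.subtypeProdEquivProd (p := fun x => x = σ' none)
        (q := fun p : Perm {b // b ≠ a} => FullCyc p ∧ ∀ k ∈ S', p k = removeNone σ' k)),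
      Nat.card_prod]
    have := ih _ (removeNone σ') S' ((fullCyc_removeNone_iff σ' hn).2 hσ') hS' (by omega)
    unfold Agree at this
    rw [this, hb]
    simp
    congr 1
    omega

theorem FullCyc.exists_conj {α : Type} [Fintype α] {σ τ : Perm α} (hσ : FullCyc σ)
    (hτ : FullCyc τ) : ∃ π : Perm α, π⁻¹ * σ * π = τ := by
  classical
  by_cases hs : Subsingleton α
  · exact ⟨1, Subsingleton.elim _ _⟩
  · have hnt : Nontrivial α := not_subsingleton_iff_nontrivial.1 hs
    obtain ⟨a⟩ : Nonempty α := inferInstance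
    have c : ∀ {f : Perm α}, FullCyc f → f.IsCycle ∧ f.support = Finset.univ := by
      intro f hf
      refine ⟨⟨a, hf.ne a, fun y _ => hf a y⟩, ?_⟩
      ext x; simp [hf.ne x]
    obtain ⟨π, hπ⟩ := isConj_iff.1 (((c hτ).1.isConj_iff (c hσ).1).2
      (by rw [(c hσ).2, (c hτ).2]))
    exact ⟨π, by rw [← hπ]; group⟩

theorem fullCyc_conj {α : Type} (σ π : Perm α) (h : FullCyc σ) : FullCyc (π⁻¹ * σ * π) := by
  intro x y
  have := (sameCycle_conj (f := σ) (g := π⁻¹) (x := x) (y := y)).2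
  rw [inv_inv] at this
  exact this (h _ _)

theorem card_fibre {α : Type} [Fintype α] (σ : Perm α) (hσ : FullCyc σ) (P : Perm α → Prop) :
    Nat.card {π : Perm α // P (π⁻¹ * σ * π)} =
      Nat.card {τ : Perm α // FullCyc τ ∧ P τ} * Nat.card {π : Perm α // π⁻¹ * σ * π = σ} := by
  classical
  choose! f hf using fun τ (hτ : FullCyc τ) => hσ.exists_conj hτ
  rw [← Nat.card_prod]
  refine Nat.card_congr
    { toFun := fun π => (⟨π.1⁻¹ * σ * π.1, fullCyc_conj _ _ hσ, π.2⟩,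
        ⟨π.1 * (f (π.1⁻¹ * σ * π.1))⁻¹, ?_⟩)
      invFun := fun q => ⟨q.2.1 * f q.1.1, ?_⟩
      left_inv := ?_
      right_inv := ?_ }
  · have := hf _ (fullCyc_conj σ π.1 hσ)
    generalize f (π.1⁻¹ * σ * π.1) = g at *
    have h2 : π.1 * (g⁻¹ * σ * g) * π.1⁻¹ = σ := by rw [this]; group
    have h3 : g * (π.1⁻¹ * σ * π.1) * g⁻¹ = σ := by rw [← this]; group
    rw [mul_inv_rev, inv_inv]
    simpa only [mul_assoc] using h3
  · have h1 := q.2.2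
    have h2 := hf _ q.1.2.1
    have : (q.2.1 * f q.1.1)⁻¹ * σ * (q.2.1 * f q.1.1) = q.1.1 := by
      calc _ = (f q.1.1)⁻¹ * (q.2.1⁻¹ * σ * q.2.1) * f q.1.1 := by group
        _ = _ := by rw [h1, h2]
    rw [this]
    exact q.1.2.2
  · intro π
    simp
  · intro q
    have h1 := q.2.2
    have h2 := hf _ q.1.2.1
    have : (q.2.1 * f q.1.1)⁻¹ * σ * (q.2.1 * f q.1.1) = q.1.1 := by
      calc _ = (f q.1.1)⁻¹ * (q.2.1⁻¹ * σ * q.2.1) * f q.1.1 := by group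
        _ = _ := by rw [h1, h2]
    refine Prod.ext (Subtype.ext this) (Subtype.ext ?_)
    simp only [this]
    group

theorem card_centr {α : Type} [Fintype α] [Nonempty α] (σ : Perm α) (hσ : FullCyc σ) :
    Nat.card {π : Perm α // π⁻¹ * σ * π = σ} = Fintype.card α := by
  classical
  obtain ⟨n, hn⟩ : ∃ n, Fintype.card α = n + 1 :=
    ⟨Fintype.card α - 1, by have := Fintype.card_pos (α := α); omega⟩
  have h := card_fibre σ hσ (fun _ => True)
  simp only [and_true] at h
  rw [card_fullCyc n α hn] at h
  have h2 : Nat.card {π : Perm α // True} = (n + 1).factorial := by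
    rw [Nat.card_congr (Equiv.subtypeUnivEquiv (fun _ => trivial)), Nat.card_eq_fintype_card,
      Fintype.card_perm, hn]
  rw [h2, Nat.factorial_succ, mul_comm] at h
  rw [hn]
  exact (Nat.eq_of_mul_eq_mul_left (Nat.factorial_pos n) h).symm

theorem card_contain {α : Type} [Fintype α] [Nonempty α] (σ : Perm α) (hσ : FullCyc σ)
    (S : Finset α) : Nat.card {π : Perm α // ∀ k ∈ S, π (σ k) = σ (π k)} =
      (if S.card < Fintype.card α then (Fintype.card α - S.card - 1).factorial else 1)
        * Fintype.card α := by
  have h := card_fibre σ hσ (fun τ => ∀ k ∈ S, τ k = σ k)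
  rw [card_centr σ hσ] at h
  have e : {π : Perm α // ∀ k ∈ S, π (σ k) = σ (π k)} ≃
      {π : Perm α // ∀ k ∈ S, (π⁻¹ * σ * π) k = σ k} :=
    Equiv.subtypeEquivRight (fun π => by
      refine forall_congr' fun k => forall_congr' fun _ => ?_
      simp only [Perm.mul_apply, Perm.inv_eq_iff_eq]
      exact eq_comm)
  rw [Nat.card_congr e, h]
  congr 1
  split_ifs with hS
  · exact card_agree _ α σ S hσ rfl hS
  · have : S = Finset.univ := by
      rw [← Finset.card_eq_iff_eq_univ]
      exact le_antisymm (Finset.card_le_univ S) (not_lt.1 hS)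
    subst this
    have : Unique {τ : Perm α // FullCyc τ ∧ ∀ k ∈ Finset.univ, τ k = σ k} :=
      { default := ⟨σ, hσ, fun _ _ => rfl⟩
        uniq := fun a => Subtype.ext (Equiv.ext fun k => a.2.2 k (Finset.mem_univ k)) }
    exact Nat.card_unique

theorem incl_excl_coeff (u m : ℕ) :
    ∑ j ∈ Finset.range (u + 1), (u.choose j) • ((-1 : ℤ) ^ (j + m) * (j.choose m : ℤ)) =
      if u = m then 1 else 0 := by
  rcases lt_or_ge u m with h | h
  · rw [if_neg h.ne]
    refine Finset.sum_eq_zero fun j hj => ?_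
    rw [Finset.mem_range] at hj
    rw [Nat.choose_eq_zero_of_lt (show j < m by omega)]
    simp
  · obtain ⟨d, rfl⟩ := Nat.exists_eq_add_of_le h
    rw [show m + d + 1 = m + (d + 1) by ring, Finset.sum_range_add]
    rw [Finset.sum_eq_zero, zero_add]
    · have : ∀ i ∈ Finset.range (d + 1), ((m + d).choose (m + i)) •
          ((-1 : ℤ) ^ (m + i + m) * ((m + i).choose m : ℤ)) =
          ((m + d).choose m : ℤ) * ((-1) ^ i * (d.choose i : ℤ)) := by
        intro i _
        have h1 := Nat.choose_mul (n := m + d) (k := m + i) (s := m) (by omega)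
        simp only [Nat.add_sub_cancel_left] at h1
        have h2 : (-1 : ℤ) ^ (m + i + m) = (-1) ^ i := by
          rw [show m + i + m = 2 * m + i by ring, pow_add, pow_mul]; simp
        have h3 : (((m + d).choose (m + i) : ℤ)) * ((m + i).choose m : ℤ) =
          ((m + d).choose m : ℤ) * (d.choose i : ℤ) := by exact_mod_cast h1
        rw [h2, nsmul_eq_mul]
        linear_combination (-1) ^ i * h3
      rw [Finset.sum_congr rfl this, ← Finset.mul_sum, Int.alternating_sum_range_choose]
      by_cases hd : d = 0 <;> simp [hd]
    · intro j hj
      rw [Finset.mem_range] at hj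
      rw [Nat.choose_eq_zero_of_lt hj]
      simp

theorem incl_excl {α ι : Type} [Fintype α] [DecidableEq α] [Fintype ι] (U : ι → Finset α)
    (N : ℕ → ℕ) (hN : ∀ S : Finset α, (Finset.univ.filter (fun i => S ⊆ U i)).card = N S.card)
    (m : ℕ) : ((Finset.univ.filter (fun i => (U i).card = m)).card : ℤ) =
      ∑ j ∈ Finset.range (Fintype.card α + 1),
        ((Fintype.card α).choose j) • ((-1 : ℤ) ^ (j + m) * (j.choose m : ℤ) * (N j : ℤ)) := by
  have h1 : ∀ i, (if (U i).card = m then (1 : ℤ) else 0) =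
      ∑ S : Finset α, if S ⊆ U i then ((-1 : ℤ) ^ (S.card + m) * (S.card.choose m : ℤ)) else 0 := by
    intro i
    rw [← Finset.sum_filter]
    have : Finset.univ.filter (fun S => S ⊆ U i) = (U i).powerset := by ext; simp
    rw [this, Finset.sum_powerset_apply_card
      (f := fun j => ((-1 : ℤ) ^ (j + m) * (j.choose m : ℤ))), incl_excl_coeff]
  rw [Finset.card_filter]
  push_cast
  rw [Finset.sum_congr rfl (fun i _ => h1 i), Finset.sum_comm]
  rw [← Finset.card_univ, ← Finset.sum_powerset_apply_card
      (f := fun j => ((-1 : ℤ) ^ (j + m) * (j.choose m : ℤ) * (N j : ℤ))), Finset.powerset_univ]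
  refine Finset.sum_congr rfl fun S _ => ?_
  rw [← Finset.sum_filter, Finset.sum_const, hN, nsmul_eq_mul]
  ring

theorem cyclicSucc_injective {n : ℕ} : Function.Injective (cyclicSucc : Fin n → Fin n) := by
  intro a b h
  have h1 : ((a : ℕ) + 1) % n = ((b : ℕ) + 1) % n := congrArg Fin.val h
  have h2 : (a : ℕ) ≡ b [MOD n] := Nat.ModEq.add_right_cancel' 1 h1
  exact Fin.ext (Nat.ModEq.eq_of_lt_of_lt h2 a.2 b.2)

/-- the rotation as a permutation -/
noncomputable def rot (n : ℕ) : Perm (Fin n) :=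
  Equiv.ofBijective cyclicSucc (Finite.injective_iff_bijective.1 cyclicSucc_injective)

theorem rot_apply {n : ℕ} (k : Fin n) : rot n k = cyclicSucc k := rfl

theorem fullCyc_rot (n : ℕ) : FullCyc (rot n) := by
  have key : ∀ (h0 : 0 < n) (k : ℕ) (hk : k < n), (rot n).SameCycle ⟨0, h0⟩ ⟨k, hk⟩ := by
    intro h0 k
    induction k with
    | zero => intro hk; exact SameCycle.refl _ _
    | succ k ih =>
      intro hk
      have : (⟨k + 1, hk⟩ : Fin n) = rot n ⟨k, by omega⟩ := by
        rw [rot_apply]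
        exact Fin.ext (Nat.mod_eq_of_lt hk).symm
      rw [this, sameCycle_apply_right]
      exact ih _
  intro x y
  exact (key x.pos x x.2).symm.trans (key x.pos y y.2)

theorem count_formula (n m : ℕ) (hn : 1 ≤ n) :
    ((Finset.univ.filter (fun π : Equiv.Perm (Fin n) =>
        (Finset.univ.filter (fun k : Fin n =>
          π (cyclicSucc k) = cyclicSucc (π k))).card = m)).card : ℤ) =
    ∑ j ∈ Finset.range (n + 1), (n.choose j) • ((-1 : ℤ) ^ (j + m) * (j.choose m : ℤ) *
      (((if j < n then (n - j - 1).factorial else 1) * n : ℕ) : ℤ)) := by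
  have : Nonempty (Fin n) := ⟨⟨0, hn⟩⟩
  have h := incl_excl (fun π : Perm (Fin n) => Finset.univ.filter (fun k : Fin n =>
          π (cyclicSucc k) = cyclicSucc (π k)))
    (fun j => (if j < n then (n - j - 1).factorial else 1) * n) (by
      intro S
      have h := card_contain (rot n) (fullCyc_rot n) S
      rw [Fintype.card_fin] at h
      rw [← h, Nat.card_eq_fintype_card, Fintype.card_subtype]
      congr 1
      ext π
      rw [Finset.mem_filter, Finset.mem_filter]
      simp [Finset.subset_iff, rot_apply]) m
  rw [Fintype.card_fin] at h
  exact h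

theorem main_term (n m h : ℕ) (hh : m + h < n) :
    ((n.choose (m + h) : ℚ) * ((-1) ^ (m + h + m) * ((m + h).choose m : ℚ) *
      ((n - (m + h) - 1).factorial * n))) / n.factorial =
    (1 / (m.factorial : ℚ)) * ((-1 : ℚ) ^ h * (1 / (h.factorial : ℚ)) *
      ((n : ℚ) / ((n - m - h : ℕ) : ℚ))) := by
  obtain ⟨d, rfl⟩ : ∃ d, n = m + h + (d + 1) := ⟨n - (m + h) - 1, by omega⟩
  have e1 : m + h + (d + 1) - (m + h) - 1 = d := by omega
  have e2 : m + h + (d + 1) - m - h = d + 1 := by omega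
  have h2 : (-1 : ℚ) ^ (m + h + m) = (-1) ^ h := by
    rw [show m + h + m = 2 * m + h by ring, pow_add, pow_mul]; simp
  rw [e1, e2, h2, Nat.choose_symm_add, Nat.add_choose, Nat.choose_symm_add, Nat.add_choose,
    Nat.cast_div (Nat.factorial_mul_factorial_dvd_factorial_add _ _) (by positivity),
    Nat.cast_div (Nat.factorial_mul_factorial_dvd_factorial_add _ _) (by positivity),
    Nat.factorial_succ d]
  push_cast
  have := Nat.factorial_pos
  have a1 : ((m + h + (d + 1)).factorial : ℚ) ≠ 0 := by positivity
  have a2 : ((m + h).factorial : ℚ) ≠ 0 := by positivity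
  have a3 : (m.factorial : ℚ) ≠ 0 := by positivity
  have a4 : (h.factorial : ℚ) ≠ 0 := by positivity
  have a5 : (d.factorial : ℚ) ≠ 0 := by positivity
  have a6 : (d + 1 : ℚ) ≠ 0 := by positivity
  field_simp

end CycPerm

/-- For a uniformly random permutation `Π` of `[n]`, let
`U_n = {k ∈ [n] : Π(k+1 mod n) = Π(k)+1 mod n}`.  Then for `0 ≤ m ≤ n`,
`P{#U_n = m} = (1/m!)·(Σ_{h=0}^{n-m-1} (-1)^h (1/h!)·n/(n-m-h) + (-1)^{n-m}·n/(n-m)!)`. -/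
theorem stmt10 (n m : ℕ) (hn : 1 ≤ n) (hm : m ≤ n) :
    ((Finset.univ.filter (fun π : Equiv.Perm (Fin n) =>
        (Finset.univ.filter (fun k : Fin n =>
          π (cyclicSucc k) = cyclicSucc (π k))).card = m)).card : ℚ)
      / (Nat.factorial n : ℚ)
    =
    (1 / (Nat.factorial m : ℚ)) *
      ((∑ h ∈ Finset.range (n - m),
          (-1 : ℚ) ^ h * (1 / (Nat.factorial h : ℚ)) * ((n : ℚ) / ((n - m - h : ℕ) : ℚ)))
        + (-1 : ℚ) ^ (n - m) * ((n : ℚ) / (Nat.factorial (n - m) : ℚ))) := by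
  have hc := congrArg (Int.cast : ℤ → ℚ) (CycPerm.count_formula n m hn)
  rw [Int.cast_natCast] at hc
  simp only [nsmul_eq_mul] at hc
  rw [hc]
  obtain ⟨d, rfl⟩ := Nat.exists_eq_add_of_le hm
  rw [show m + d + 1 = m + (d + 1) by ring, Finset.sum_range_add]
  rw [Finset.sum_eq_zero (s := Finset.range m), zero_add]
  · rw [Finset.sum_range_succ]
    rw [Int.cast_add, Int.cast_sum, add_div, Finset.sum_div, mul_add (1 / (m.factorial : ℚ)), Finset.mul_sum]
    congr 1
    · rw [Nat.add_sub_cancel_left]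
      refine Finset.sum_congr rfl fun h hh => ?_
      rw [Finset.mem_range] at hh
      have := CycPerm.main_term (m + d) m h (by omega)
      rw [Nat.add_sub_cancel_left] at this
      rw [← this, if_pos (by omega)]
      push_cast
      rfl
    · push_cast
      have h2 : (-1 : ℚ) ^ (m + d + m) = (-1) ^ d := by
        rw [show m + d + m = 2 * m + d by ring, pow_add, pow_mul]; simp
      rw [h2, Nat.add_sub_cancel_left, if_neg (by omega), Nat.choose_self, Nat.choose_symm_add, Nat.add_choose,
        Nat.cast_div (Nat.factorial_mul_factorial_dvd_factorial_add _ _) (by positivity)]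
      push_cast
      have a1 : ((m + d).factorial : ℚ) ≠ 0 := by positivity
      have a3 : (m.factorial : ℚ) ≠ 0 := by positivity
      have a4 : (d.factorial : ℚ) ≠ 0 := by positivity
      field_simp
  · intro j hj
    rw [Finset.mem_range] at hj
    rw [Nat.choose_eq_zero_of_lt hj]
    simp
end
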